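/- Suppose (a,b,c) ≠ (0,0,0) and the number of points of PG(3,q²) lying on both H and Q is exactly 2q³ + q² + 1. Then Δ = 4ab − c² is a nonzero square in F (Q is hyperbolic), and there exist at least 2(q+1) distinct 2-dimensional F-subspaces W of F⁴ such that both the quadratic form j·z − a·x² − b·y² − c·x·y − d·x·j − e·y·j − f·j² and the Hermitian form j^q·z + j·z^q − x^(q+1) − y^(q+1) vanish identically on W; that is, at least 2(q+1) lines of PG(3,q²) are entirely contained in H ∩ Q. -/

import Mathlib

/-- The Hermitian form defining the Hermitian surface `H` of `PG(3,q²)`. -/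
def hermForm (q : ℕ) {F : Type} [Field F] (v : Fin 4 → F) : F :=
  (v 0) ^ q * v 3 + v 0 * (v 3) ^ q - (v 1) ^ (q + 1) - (v 2) ^ (q + 1)

/-- The quadratic form defining the quadric `Q`. -/
def quadForm {F : Type} [Field F] (a b c d e f : F) (v : Fin 4 → F) : F :=
  v 0 * v 3 - a * (v 1) ^ 2 - b * (v 2) ^ 2 - c * (v 1) * (v 2) -
    d * (v 1) * (v 0) - e * (v 2) * (v 0) - f * (v 0) ^ 2

open Polynomial in
lemma card_le_of_forall_eval_eq_zero {F : Type} [Field F] (P : F[X]) (n k : ℕ)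
    (hdeg : P.natDegree ≤ n) (hk : P.coeff k ≠ 0) (S : Finset F)
    (hS : ∀ x ∈ S, P.eval x = 0) : S.card ≤ n := by
  have hP : P ≠ 0 := fun h => hk (by simp [h])
  refine (Polynomial.card_le_degree_of_subset_roots (p := P) fun x hx => ?_).trans hdeg
  exact (Polynomial.mem_roots hP).2 (hS x hx)

lemma hermForm_smul (q : ℕ) {F : Type} [Field F] (l : F) (v : Fin 4 → F) :
    hermForm q (l • v) = l ^ (q + 1) * hermForm q v := by
  simp only [hermForm, Pi.smul_apply, smul_eq_mul]
  ring

lemma quadForm_smul {F : Type} [Field F] (a b c d e f l : F) (v : Fin 4 → F) :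
    quadForm a b c d e f (l • v) = l ^ 2 * quadForm a b c d e f v := by
  simp only [quadForm, Pi.smul_apply, smul_eq_mul]
  ring

section Counting

variable {F : Type} [Field F] (q : ℕ) (a b c d e f : F)

/-- The affine chart `j = 1` of the quadric as the graph of a function of `(x, y)`. -/
def chartHeight (x y : F) : F :=
  a * x ^ 2 + b * y ^ 2 + c * x * y + d * x + e * y + f

/-- The slopes `w` for which `[0:1:w:0]` lies on both the Hermitian surface and the quadric. -/
def IsCommonSlope (w : F) : Prop :=
  w ^ (q + 1) = -1 ∧ a + c * w + b * w ^ 2 = 0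

/-- The slope in the `z`-direction of the quadric along the line `y = s + w x`. -/
def lineSlope (w s : F) : F := 2 * b * w * s + c * s + d + e * w

/-- The affine line `y = s + w x` lifts to a line of the Hermitian surface. -/
def IsCommonIntercept (w s : F) : Prop :=
  lineSlope b c d e w s = s ^ q * w ∧
    chartHeight a b c d e f 0 s + chartHeight a b c d e f 0 s ^ q = s ^ (q + 1)

/-- The affine points of the intersection, in the coordinates `(x, y)`. -/
def IsAffineCommonPoint (x y : F) : Prop :=
  chartHeight a b c d e f x y + chartHeight a b c d e f x y ^ q = x ^ (q + 1) + y ^ (q + 1)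

variable {q a b c d e f}

lemma chartHeight_on_line {w : F} (hw : IsCommonSlope q a b c w) (t s : F) :
    chartHeight a b c d e f t (s + w * t) =
      lineSlope b c d e w s * t + chartHeight a b c d e f 0 s := by
  simp only [chartHeight, lineSlope]
  linear_combination t ^ 2 * hw.2

open Polynomial in
/-- For fixed `y`, at most `2q` affine points. -/
lemma card_affine_fiber_le (hq : 3 ≤ q) (hadd : ∀ x y : F, (x + y) ^ q = x ^ q + y ^ q)
    (y : F) (S : Finset F) (hS : ∀ x ∈ S, IsAffineCommonPoint q a b c d e f x y) :
    S.card ≤ 2 * q := by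
  set g : F := c * y + d
  set k : F := b * y ^ 2 + e * y + f
  refine card_le_of_forall_eval_eq_zero
    (C (a ^ q) * X ^ (2 * q) - X ^ (q + 1) + C (g ^ q) * X ^ q + C a * X ^ 2 + C g * X ^ 1
      + C (k + k ^ q - y ^ (q + 1)) * X ^ 0) (2 * q) (q + 1) ?_ ?_ S ?_
  · have h : ∀ (r : F) (m : ℕ), m ≤ 2 * q → (C r * X ^ m).natDegree ≤ 2 * q :=
      fun r m hm => (natDegree_C_mul_X_pow_le r m).trans hm
    refine natDegree_add_le_of_degree_le (natDegree_add_le_of_degree_le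
      (natDegree_add_le_of_degree_le (natDegree_add_le_of_degree_le
      ((natDegree_sub_le _ _).trans (max_le (h _ _ le_rfl) ?_)) (h _ _ ?_)) (h _ _ ?_)) (h _ _ ?_)) (h _ _ ?_)
    · rw [natDegree_X_pow]; omega
    all_goals omega
  · simp only [coeff_add, coeff_sub, coeff_C_mul, coeff_X_pow]
    rw [if_neg (by omega), if_pos trivial, if_neg (by omega), if_neg (by omega), if_neg (by omega),
      if_neg (by omega)]
    simp
  · intro x hx
    have h := hS x hx
    have e1 : chartHeight a b c d e f x y = a * x ^ 2 + g * x + k := by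
      simp only [chartHeight, g, k]; ring
    rw [IsAffineCommonPoint, e1, hadd, hadd, mul_pow, mul_pow, ← pow_mul] at h
    simp only [eval_add, eval_sub, eval_mul, eval_C, eval_pow, eval_X]
    linear_combination h

open Polynomial in
lemma card_trace_fiber_le (hq : 3 ≤ q) {l : F} (hl : l ≠ 0) (r : F) (S : Finset F)
    (hS : ∀ t ∈ S, l * t + (l * t) ^ q = r) : S.card ≤ q := by
  refine card_le_of_forall_eval_eq_zero
    (C (l ^ q) * X ^ q + C l * X ^ 1 + C (-r) * X ^ 0) q q ?_ ?_ S ?_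
  · have h : ∀ (r : F) (m : ℕ), m ≤ q → (C r * X ^ m).natDegree ≤ q :=
      fun r m hm => (natDegree_C_mul_X_pow_le r m).trans hm
    exact natDegree_add_le_of_degree_le (natDegree_add_le_of_degree_le
      (h _ _ le_rfl) (h _ _ (by omega))) (h _ _ (by omega))
  · simp only [coeff_add, coeff_C_mul, coeff_X_pow]
    rw [if_pos trivial, if_neg (by omega), if_neg (by omega)]
    simpa using fun h => absurd h hl
  · intro t ht
    have h := hS t ht
    rw [mul_pow] at h
    simp only [eval_add, eval_mul, eval_C, eval_pow, eval_X]
    linear_combination h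

open Polynomial in
lemma card_common_intercepts_le (hq : 3 ≤ q) {w : F} (hw : w ≠ 0) (S : Finset F)
    (hS : ∀ s ∈ S, IsCommonIntercept q a b c d e f w s) : S.card ≤ q := by
  refine card_le_of_forall_eval_eq_zero
    (C w * X ^ q + C (-(2 * b * w + c)) * X ^ 1 + C (-(d + e * w)) * X ^ 0) q q ?_ ?_ S ?_
  · have h : ∀ (r : F) (m : ℕ), m ≤ q → (C r * X ^ m).natDegree ≤ q :=
      fun r m hm => (natDegree_C_mul_X_pow_le r m).trans hm
    exact natDegree_add_le_of_degree_le (natDegree_add_le_of_degree_le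
      (h _ _ le_rfl) (h _ _ (by omega))) (h _ _ (by omega))
  · simp only [coeff_add, coeff_C_mul, coeff_X_pow]
    rw [if_pos trivial, if_neg (by omega), if_neg (by omega)]
    simpa using hw
  · intro s hs
    have h := (hS s hs).1
    simp only [lineSlope] at h
    simp only [eval_add, eval_mul, eval_C, eval_pow, eval_X]
    linear_combination -h

lemma IsCommonSlope.ne_zero {w : F} (hw : IsCommonSlope q a b c w) : w ≠ 0 := by
  rintro rfl
  have := hw.1
  simp at this

lemma affine_on_line (hadd : ∀ x y : F, (x + y) ^ q = x ^ q + y ^ q)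
    (hfrob : ∀ x : F, (x ^ q) ^ q = x) {w : F} (hw : IsCommonSlope q a b c w) {s t : F}
    (h : IsAffineCommonPoint q a b c d e f t (s + w * t)) :
    (lineSlope b c d e w s - s ^ q * w) * t + ((lineSlope b c d e w s - s ^ q * w) * t) ^ q =
      s ^ (q + 1) - (chartHeight a b c d e f 0 s + chartHeight a b c d e f 0 s ^ q) := by
  have hsub : ∀ x y : F, (x - y) ^ q = x ^ q - y ^ q := fun x y => by
    rw [eq_sub_iff_add_eq, ← hadd, sub_add_cancel]
  rw [IsAffineCommonPoint, chartHeight_on_line hw, hadd, mul_pow, pow_succ (s + w * t), hadd,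
    mul_pow] at h
  have h1 := hw.1
  rw [mul_pow, hsub, mul_pow (s ^ q), hfrob]
  rw [pow_succ] at h1
  linear_combination h + t ^ q * t * h1

variable [Fintype F]

open Classical in
lemma card_affine_le (hq : 3 ≤ q) (hF : Fintype.card F = q ^ 2)
    (hadd : ∀ x y : F, (x + y) ^ q = x ^ q + y ^ q) :
    (Finset.univ.filter fun P : F × F => IsAffineCommonPoint q a b c d e f P.1 P.2).card
      ≤ 2 * q ^ 3 := by
  have h := Finset.card_le_mul_card_image_of_maps_to
    (s := Finset.univ.filter fun P : F × F => IsAffineCommonPoint q a b c d e f P.1 P.2)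
    (t := Finset.univ) (f := Prod.snd) (fun _ _ => Finset.mem_univ _) (2 * q) ?_
  · rw [Finset.card_univ, hF] at h
    exact h.trans (le_of_eq (by ring))
  · intro y _
    have hinj : Set.InjOn Prod.fst (((Finset.univ.filter fun P : F × F =>
        IsAffineCommonPoint q a b c d e f P.1 P.2).filter fun P => P.2 = y : Finset (F × F)) :
          Set (F × F)) := by
      rintro ⟨x, y₁⟩ h₁ ⟨x', y₂⟩ h₂ h
      simp only [Finset.coe_filter, Finset.mem_filter, Set.mem_ofPred_eq] at h₁ h₂ h
      rw [h, h₁.2, h₂.2]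
    rw [← Finset.card_image_of_injOn hinj]
    refine card_affine_fiber_le (a := a) (b := b) (c := c) (d := d) (e := e) (f := f)
      hq hadd y _ fun x hx => ?_
    simp only [Finset.mem_image, Finset.mem_filter, Finset.mem_univ, true_and, Prod.exists] at hx
    obtain ⟨x', y', ⟨h, rfl⟩, rfl⟩ := hx
    exact h

open Classical in
lemma card_affine_le_of_isCommonSlope (hq : 3 ≤ q) (hF : Fintype.card F = q ^ 2)
    (hadd : ∀ x y : F, (x + y) ^ q = x ^ q + y ^ q) (hfrob : ∀ x : F, (x ^ q) ^ q = x)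
    {w : F} (hw : IsCommonSlope q a b c w) :
    (Finset.univ.filter fun P : F × F => IsAffineCommonPoint q a b c d e f P.1 P.2).card
      + q * (Finset.univ.filter fun s => IsCommonIntercept q a b c d e f w s).card
      ≤ q ^ 3 + q ^ 2 * (Finset.univ.filter fun s => IsCommonIntercept q a b c d e f w s).card := by
  set A := Finset.univ.filter fun P : F × F => IsAffineCommonPoint q a b c d e f P.1 P.2 with hA
  set M := Finset.univ.filter fun s => IsCommonIntercept q a b c d e f w s with hM
  have hsum := Finset.card_eq_sum_card_fiberwise (s := A) (t := Finset.univ)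
    (f := fun P => P.2 - w * P.1) (fun _ _ => Finset.mem_coe.2 (Finset.mem_univ _))
  have hfib : ∀ s : F, (A.filter fun P => P.2 - w * P.1 = s).card
      ≤ if s ∈ M then q ^ 2 else q := by
    intro s
    have hinj : Set.InjOn Prod.fst ((A.filter fun P => P.2 - w * P.1 = s : Finset (F × F)) :
          Set (F × F)) := by
      rintro ⟨x, y₁⟩ h₁ ⟨x', y₂⟩ h₂ h
      simp only [Finset.coe_filter, Set.mem_ofPred_eq] at h₁ h₂ h
      subst h
      rw [Prod.mk.injEq]
      exact ⟨rfl, by linear_combination h₁.2 - h₂.2⟩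
    rw [← Finset.card_image_of_injOn hinj]
    split_ifs with hs
    · exact (Finset.card_le_univ _).trans hF.le
    have hmem : ∀ t ∈ (A.filter fun P => P.2 - w * P.1 = s).image Prod.fst,
        IsAffineCommonPoint q a b c d e f t (s + w * t) := by
      intro t ht
      simp only [hA, Finset.mem_image, Finset.mem_filter, Finset.mem_univ, true_and,
        Prod.exists] at ht
      obtain ⟨x', y', ⟨h, rfl⟩, rfl⟩ := ht
      simpa using h
    by_cases hl : lineSlope b c d e w s - s ^ q * w = 0
    · rw [Finset.card_eq_zero.2]
      · exact Nat.zero_le _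
      refine Finset.eq_empty_of_forall_notMem fun t ht => hs ?_
      have h := affine_on_line hadd hfrob hw (hmem t ht)
      rw [hl, zero_mul, zero_pow (by omega)] at h
      simp only [hM, Finset.mem_filter, Finset.mem_univ, true_and]
      exact ⟨sub_eq_zero.1 hl, by linear_combination h⟩
    · exact card_trace_fiber_le hq hl _ _ fun t ht => affine_on_line hadd hfrob hw (hmem t ht)
  have hle : A.card ≤ ∑ s : F, if s ∈ M then q ^ 2 else q :=
    hsum.le.trans (Finset.sum_le_sum fun s _ => hfib s)
  have hq2 : q ≤ q ^ 2 := by nlinarith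
  have hMc : M.card + (Finset.univ.filter fun s => s ∉ M).card = q ^ 2 := by
    have := Finset.card_filter_add_card_filter_not (s := (Finset.univ : Finset F)) (fun s => s ∈ M)
    rwa [Finset.filter_univ_mem, Finset.card_univ, hF] at this
  rw [Finset.sum_ite, Finset.filter_univ_mem, Finset.sum_const, Finset.sum_const, smul_eq_mul,
    smul_eq_mul] at hle
  calc A.card + q * M.card
      ≤ (M.card * q ^ 2 + (Finset.univ.filter fun s => s ∉ M).card * q) + q * M.card := by gcongr
    _ = q * (M.card + (Finset.univ.filter fun s => s ∉ M).card) + q ^ 2 * M.card := by ring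
    _ = q ^ 3 + q ^ 2 * M.card := by rw [hMc]; ring

/-- The intersection is covered by its affine points, the points on the common lines through
`[0:0:0:1]` in the plane at infinity, and that point itself. -/
lemma card_common_points_le (hq : 0 < q) :
    Nat.card {P : Projectivization F (Fin 4 → F) //
        hermForm q P.rep = 0 ∧ quadForm a b c d e f P.rep = 0} ≤
      Nat.card {P : F × F // IsAffineCommonPoint q a b c d e f P.1 P.2} +
        (Nat.card {w : F // IsCommonSlope q a b c w} * Nat.card F + 1) := by
  let g : {P : F × F // IsAffineCommonPoint q a b c d e f P.1 P.2} ⊕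
      (({w : F // IsCommonSlope q a b c w} × F) ⊕ Unit) → Projectivization F (Fin 4 → F) :=
    Sum.elim
      (fun P => Projectivization.mk F
        ![1, P.1.1, P.1.2, chartHeight a b c d e f P.1.1 P.1.2]
        (fun h => one_ne_zero (congrFun h 0)))
      (Sum.elim
        (fun P => Projectivization.mk F ![0, 1, P.1.1, P.2] (fun h => one_ne_zero (congrFun h 1)))
        (fun _ => Projectivization.mk F ![0, 0, 0, 1] (fun h => one_ne_zero (congrFun h 3))))
  have hsub : {P : Projectivization F (Fin 4 → F) |
      hermForm q P.rep = 0 ∧ quadForm a b c d e f P.rep = 0} ⊆ Set.range g := by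
    rintro P ⟨hh, hQ⟩
    obtain ⟨v, hne, hv, hmk⟩ : ∃ v, ∃ h : v ≠ 0, P.rep = v ∧ Projectivization.mk F v h = P :=
      ⟨P.rep, P.rep_nonzero, rfl, P.mk_rep⟩
    rw [hv] at hh hQ
    rw [← hmk]
    clear hv hmk
    have hscale : ∀ (l : F) (u : Fin 4 → F), l ≠ 0 → v = l • u →
        hermForm q u = 0 ∧ quadForm a b c d e f u = 0 := by
      rintro l u hl rfl
      rw [hermForm_smul] at hh
      rw [quadForm_smul] at hQ
      exact ⟨(mul_eq_zero.1 hh).resolve_left (pow_ne_zero _ hl),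
        (mul_eq_zero.1 hQ).resolve_left (pow_ne_zero _ hl)⟩
    by_cases h0 : v 0 = 0
    · by_cases h1 : v 1 = 0
      · have h2 : v 2 = 0 := by
          simpa [hermForm, h0, h1, hq.ne'] using hh
        refine ⟨Sum.inr (Sum.inr ()), ?_⟩
        refine (Projectivization.mk_eq_mk_iff' F _ _ _ _).2 ⟨(v 3)⁻¹, ?_⟩
        have h3 : v 3 ≠ 0 := fun h3 => hne (by ext i; fin_cases i <;> simp [*])
        ext i
        fin_cases i <;> simp [*]
      · have hu : v = v 1 • ![0, 1, v 2 / v 1, v 3 / v 1] := by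
          ext i
          fin_cases i <;> simp [h0] <;> field_simp
        obtain ⟨e1, e2⟩ := hscale _ _ h1 hu
        refine ⟨Sum.inr (Sum.inl (⟨v 2 / v 1, ?_, ?_⟩, v 3 / v 1)), ?_⟩
        · simp [hermForm, hq.ne'] at e1
          linear_combination -e1
        · simp [quadForm] at e2
          linear_combination -e2
        · exact (Projectivization.mk_eq_mk_iff' F _ _ _ _).2
            ⟨(v 1)⁻¹, by rw [inv_smul_eq_iff₀ h1]; exact hu⟩
    · have hu : v = v 0 • ![1, v 1 / v 0, v 2 / v 0, v 3 / v 0] := by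
        ext i
        fin_cases i <;> simp <;> field_simp
      obtain ⟨e1, e2⟩ := hscale _ _ h0 hu
      have e3 : chartHeight a b c d e f (v 1 / v 0) (v 2 / v 0) = v 3 / v 0 := by
        simp [quadForm] at e2
        simp only [chartHeight]
        linear_combination -e2
      refine ⟨Sum.inl ⟨(v 1 / v 0, v 2 / v 0), ?_⟩, ?_⟩
      · rw [IsAffineCommonPoint, e3]
        simp [hermForm] at e1
        linear_combination e1
      · refine (Projectivization.mk_eq_mk_iff' F _ _ _ _).2
            ⟨(v 0)⁻¹, ?_⟩
        rw [inv_smul_eq_iff₀ h0]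
        simp only [e3]
        exact hu
  have h1 := Nat.card_mono (Set.finite_range g) hsub
  refine h1.trans ((Finite.card_range_le g).trans ?_)
  rw [Nat.card_sum, Nat.card_sum, Nat.card_prod, Nat.card_unique (α := Unit)]

end Counting

section Lines

variable {F : Type} [Field F] {q : ℕ} {a b c d e f : F}

/-- The line at infinity of slope `w`, or the lift of the affine line `y = s + w x`. -/
def commonLine (a b c d e f w : F) : Option F → Submodule F (Fin 4 → F)
  | none => Submodule.span F {![0, 1, w, 0], ![0, 0, 0, 1]}
  | some s => Submodule.span F
      {![0, 1, w, lineSlope b c d e w s], ![1, 0, s, chartHeight a b c d e f 0 s]}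

lemma finrank_commonLine (w : F) (o : Option F) :
    Module.finrank F (commonLine a b c d e f w o) = 2 := by
  cases o with
  | none =>
    have h : LinearIndependent F ![![0, 1, w, 0], ![(0 : F), 0, 0, 1]] := by
      rw [LinearIndependent.pair_iff]
      intro s t h
      exact ⟨by simpa using congrFun h 1, by simpa using congrFun h 3⟩
    rw [commonLine, ← Matrix.range_cons_cons_empty _ _ ![], finrank_span_eq_card h, Fintype.card_fin]
  | some s =>
    have h : LinearIndependent F ![![0, 1, w, lineSlope b c d e w s],
        ![(1 : F), 0, s, chartHeight a b c d e f 0 s]] := by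
      rw [LinearIndependent.pair_iff]
      intro s t h
      exact ⟨by simpa using congrFun h 1, by simpa using congrFun h 0⟩
    rw [commonLine, ← Matrix.range_cons_cons_empty _ _ ![], finrank_span_eq_card h, Fintype.card_fin]

lemma commonLine_injective {w w' : F} {o o' : Option F}
    (h : commonLine a b c d e f w o = commonLine a b c d e f w' o') : w = w' ∧ o = o' := by
  have hfst : ∀ (u : F) (v : Fin 4 → F), v ∈ commonLine a b c d e f u none → v 0 = 0 := by
    intro u v hv
    obtain ⟨α, β, rfl⟩ := Submodule.mem_span_pair.1 hv
    simp
  cases o with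
  | none =>
    cases o' with
    | none =>
      have hm : ![0, 1, w, 0] ∈ commonLine a b c d e f w' none :=
        h ▸ Submodule.subset_span (Set.mem_insert _ _)
      obtain ⟨α, β, hv⟩ := Submodule.mem_span_pair.1 hm
      have h1 := congrFun hv 1
      have h2 := congrFun hv 2
      simp at h1 h2
      subst h1
      simp [← h2]
    | some s' =>
      have hm : ![1, 0, s', chartHeight a b c d e f 0 s'] ∈ commonLine a b c d e f w none :=
        h ▸ Submodule.subset_span (Set.mem_insert_of_mem _ rfl)
      exact absurd (hfst _ _ hm) one_ne_zero
  | some s =>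
    have hm : ![1, 0, s, chartHeight a b c d e f 0 s] ∈ commonLine a b c d e f w' o' :=
      h ▸ Submodule.subset_span (Set.mem_insert_of_mem _ rfl)
    have hm' : ![0, 1, w, lineSlope b c d e w s] ∈ commonLine a b c d e f w' o' :=
      h ▸ Submodule.subset_span (Set.mem_insert _ _)
    cases o' with
    | none => exact absurd (hfst _ _ hm) one_ne_zero
    | some s' =>
      obtain ⟨α, β, hv⟩ := Submodule.mem_span_pair.1 hm
      obtain ⟨γ, δ, hv'⟩ := Submodule.mem_span_pair.1 hm'
      have h0 := congrFun hv 0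
      have h1 := congrFun hv 1
      have h2 := congrFun hv 2
      have h0' := congrFun hv' 0
      have h1' := congrFun hv' 1
      have h2' := congrFun hv' 2
      simp at h0 h1 h2 h0' h1' h2'
      subst h0 h1 h0' h1'
      simp at h2 h2'
      exact ⟨h2'.symm, congrArg some h2.symm⟩

lemma forms_eq_zero_of_mem_commonLine (hq : 0 < q)
    (hadd : ∀ x y : F, (x + y) ^ q = x ^ q + y ^ q) (hfrob : ∀ x : F, (x ^ q) ^ q = x)
    {w : F} (hw : IsCommonSlope q a b c w) {o : Option F}
    (ho : ∀ s ∈ o, IsCommonIntercept q a b c d e f w s) {v : Fin 4 → F}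
    (hv : v ∈ commonLine a b c d e f w o) :
    quadForm a b c d e f v = 0 ∧ hermForm q v = 0 := by
  have hw1 := hw.1
  have hw2 := hw.2
  rw [pow_succ] at hw1
  cases o with
  | none =>
    obtain ⟨α, β, rfl⟩ := Submodule.mem_span_pair.1 hv
    constructor
    · simp [quadForm]
      linear_combination -α ^ 2 * hw2
    · simp [hermForm, hq.ne']
      rw [pow_succ, pow_succ, mul_pow]
      linear_combination -α ^ q * α * hw1
  | some s =>
    obtain ⟨h1, h2⟩ := ho s rfl
    obtain ⟨β, α, rfl⟩ := Submodule.mem_span_pair.1 hv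
    constructor
    · simp [quadForm, lineSlope, chartHeight]
      linear_combination -β ^ 2 * hw2
    · simp [hermForm]
      rw [h1, pow_succ, pow_succ, hadd, hadd, mul_pow, mul_pow, mul_pow, mul_pow, mul_pow, hfrob]
      rw [pow_succ] at h2
      linear_combination α ^ q * α * h2 - β ^ q * β * hw1

end Lines

/-- If two slopes occur, the quadric is hyperbolic. -/
lemma isSquare_of_two_slopes {F : Type} [Field F] {q : ℕ} {a b c : F}
    (habc : ¬ (a = 0 ∧ b = 0 ∧ c = 0)) (hneg : IsSquare (-1 : F)) {w w' : F} (hne : w ≠ w')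
    (hw : IsCommonSlope q a b c w) (hw' : IsCommonSlope q a b c w') :
    IsSquare (4 * a * b - c ^ 2) ∧ 4 * a * b - c ^ 2 ≠ 0 := by
  have hd : w - w' ≠ 0 := sub_ne_zero.2 hne
  have hc : c = -b * (w + w') := by
    refine mul_left_cancel₀ hd ?_
    linear_combination hw.2 - hw'.2
  have ha : a = b * (w * w') := by
    linear_combination hw.2 - w * hc
  have hb : b ≠ 0 := by
    rintro rfl
    exact habc ⟨by simpa using ha, rfl, by simpa using hc⟩
  have hΔ : 4 * a * b - c ^ 2 = -1 * (b * (w - w')) ^ 2 := by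
    rw [ha, hc]; ring
  rw [hΔ]
  exact ⟨hneg.mul (IsSquare.sq _), by simp [hb, hd]⟩

open Polynomial in
lemma card_common_slopes_le {F : Type} [Field F] {q : ℕ} {a b c : F}
    (habc : ¬ (a = 0 ∧ b = 0 ∧ c = 0)) (S : Finset F) (hS : ∀ w ∈ S, IsCommonSlope q a b c w) :
    S.card ≤ 2 := by
  have hne : ∃ k, (C b * X ^ 2 + C c * X + C a : F[X]).coeff k ≠ 0 := by
    by_contra! h
    have h0 := h 0
    have h1 := h 1
    have h2 := h 2
    simp [coeff_X, coeff_C, coeff_X_pow] at h0 h1 h2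
    exact habc ⟨h0, h2, h1⟩
  obtain ⟨k, hk⟩ := hne
  refine card_le_of_forall_eval_eq_zero _ 2 k natDegree_quadratic_le hk S fun w hw => ?_
  have h := (hS w hw).2
  simp only [eval_add, eval_mul, eval_C, eval_pow, eval_X]
  linear_combination h

lemma le_card_common_lines {F : Type} [Field F] [Fintype F] {q : ℕ} {a b c d e f : F}
    (hq : 0 < q) (hadd : ∀ x y : F, (x + y) ^ q = x ^ q + y ^ q)
    (hfrob : ∀ x : F, (x ^ q) ^ q = x)
    (hS : ∀ w, IsCommonSlope q a b c w → q ≤ Nat.card {s // IsCommonIntercept q a b c d e f w s}) :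
    Nat.card {w // IsCommonSlope q a b c w} * (q + 1) ≤
      Nat.card {W : Submodule F (Fin 4 → F) //
        Module.finrank F W = 2 ∧
        ∀ v ∈ W, quadForm a b c d e f v = 0 ∧ hermForm q v = 0} := by
  classical
  let g : (Σ w : {w // IsCommonSlope q a b c w},
      Option {s // IsCommonIntercept q a b c d e f w.1 s}) →
      {W : Submodule F (Fin 4 → F) // Module.finrank F W = 2 ∧
        ∀ v ∈ W, quadForm a b c d e f v = 0 ∧ hermForm q v = 0} := fun P =>
    ⟨commonLine a b c d e f P.1.1 (P.2.map Subtype.val), finrank_commonLine _ _, fun v hv => by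
      refine forms_eq_zero_of_mem_commonLine hq hadd hfrob P.1.2 (fun s hs => ?_) hv
      obtain ⟨s', -, rfl⟩ := Option.mem_map.1 hs
      exact s'.2⟩
  have hg : Function.Injective g := by
    rintro ⟨⟨w, hw⟩, o⟩ ⟨⟨w', hw'⟩, o'⟩ h
    obtain ⟨h1, h2⟩ := commonLine_injective (congrArg Subtype.val h)
    dsimp only at h1
    subst h1
    obtain rfl : o = o' := Option.map_injective Subtype.val_injective h2
    rfl
  refine le_trans ?_ (Nat.card_le_card_of_injective g hg)
  rw [Nat.card_sigma, Nat.card_eq_fintype_card, ← smul_eq_mul, ← Finset.card_univ,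
    ← Finset.sum_const]
  refine Finset.sum_le_sum fun w _ => ?_
  rw [Finite.card_option]
  exact Nat.succ_le_succ (hS w.1 w.2)

theorem maximal_intersection_has_many_lines
    (q : ℕ) (hq : ∃ p n : ℕ, p.Prime ∧ Odd p ∧ 0 < n ∧ q = p ^ n)
    (F : Type) [Field F] [Fintype F] (hF : Fintype.card F = q ^ 2)
    (a b c d e f : F) (habc : ¬ (a = 0 ∧ b = 0 ∧ c = 0))
    (hcard : Nat.card {P : Projectivization F (Fin 4 → F) //
        hermForm q P.rep = 0 ∧ quadForm a b c d e f P.rep = 0} =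
      2 * q ^ 3 + q ^ 2 + 1) :
    (IsSquare (4 * a * b - c ^ 2) ∧ 4 * a * b - c ^ 2 ≠ 0) ∧
    2 * (q + 1) ≤ Nat.card {W : Submodule F (Fin 4 → F) //
        Module.finrank F W = 2 ∧
        ∀ v ∈ W, quadForm a b c d e f v = 0 ∧ hermForm q v = 0} := by
  classical
  obtain ⟨p, n, hp, hodd, hn, rfl⟩ := hq
  set q := p ^ n with hqdef
  have hq3 : 3 ≤ q := by
    have h2 : p ≠ 2 := by rintro rfl; exact absurd hodd (by decide)
    have h3 : 3 ≤ p := by have := hp.two_le; omega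
    exact h3.trans (Nat.le_self_pow hn.ne' p)
  have : Fact p.Prime := ⟨hp⟩
  have hF' : Fintype.card F = p ^ (n * 2) := by rw [hF, hqdef, pow_mul]
  have : CharP F p := charP_of_card_eq_prime_pow hF'
  have hadd : ∀ x y : F, (x + y) ^ q = x ^ q + y ^ q := fun x y => add_pow_char_pow x y p n
  have hfrob : ∀ x : F, (x ^ q) ^ q = x := fun x => by
    rw [← pow_mul, ← sq, ← hF, FiniteField.pow_card]
  have hneg : IsSquare (-1 : F) := by
    rw [FiniteField.isSquare_neg_one_iff, hF]
    have hqo : q % 2 = 1 := Nat.odd_iff.1 hodd.pow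
    have : q % 4 = 1 ∨ q % 4 = 3 := by omega
    rcases this with h | h <;> simp [Nat.pow_mod, h]
  have hN := card_common_points_le (a := a) (b := b) (c := c) (d := d) (e := e) (f := f)
    (q := q) (by omega)
  rw [hcard, Nat.card_eq_fintype_card (α := F), hF,
    Nat.card_eq_fintype_card (α := {P : F × F // _}), Fintype.card_subtype] at hN
  set A := (Finset.univ.filter fun P : F × F => IsAffineCommonPoint q a b c d e f P.1 P.2).card
  have hT := card_common_slopes_le habc (q := q)
    (Finset.univ.filter fun w => IsCommonSlope q a b c w) (by simp)
  have hTc : Nat.card {w // IsCommonSlope q a b c w} =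
      (Finset.univ.filter fun w => IsCommonSlope q a b c w).card := by
    rw [Nat.card_eq_fintype_card, Fintype.card_subtype]
  rw [hTc] at hN
  set T := Finset.univ.filter fun w => IsCommonSlope q a b c w
  have hA0 : A ≤ 2 * q ^ 3 := card_affine_le hq3 hF hadd
  have hTpos : 0 < T.card := by
    by_contra h
    have h0 : T.card = 0 := by omega
    rw [h0] at hN
    have : 0 < q ^ 2 := by positivity
    omega
  have hM : ∀ w, IsCommonSlope q a b c w →
      A + q * Nat.card {s // IsCommonIntercept q a b c d e f w s} ≤
        q ^ 3 + q ^ 2 * Nat.card {s // IsCommonIntercept q a b c d e f w s} ∧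
      Nat.card {s // IsCommonIntercept q a b c d e f w s} ≤ q := by
    intro w hw
    rw [Nat.card_eq_fintype_card, Fintype.card_subtype]
    exact ⟨card_affine_le_of_isCommonSlope hq3 hF hadd hfrob hw,
      card_common_intercepts_le hq3 hw.ne_zero _
        (a := a) (b := b) (c := c) (d := d) (e := e) (f := f) (by simp)⟩
  have harith : ∀ m k : ℕ, m ≤ k → q ^ 2 * m + q * k ≤ q ^ 2 * k + q * m := by
    intro m k hmk
    obtain ⟨r, rfl⟩ := Nat.exists_eq_add_of_le hmk
    have : q * r ≤ q ^ 2 * r := Nat.mul_le_mul_right r (by nlinarith)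
    linarith
  have hT2 : T.card = 2 := by
    obtain ⟨w, hw⟩ := Finset.card_pos.1 hTpos
    obtain ⟨h1, h2⟩ := hM w (Finset.mem_filter.1 hw).2
    by_contra hne
    have h0 : T.card = 1 := by omega
    rw [h0] at hN
    generalize Nat.card {s // IsCommonIntercept q a b c d e f w s} = m at h1 h2
    nlinarith [Nat.mul_le_mul_left (q ^ 2) h2, harith m q h2]
  constructor
  · obtain ⟨w, w', hne, hT'⟩ := Finset.card_eq_two.1 hT2
    have hmem : ∀ x ∈ T, IsCommonSlope q a b c x := fun x hx => (Finset.mem_filter.1 hx).2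
    exact isSquare_of_two_slopes habc hneg hne (hmem w (by simp [hT'])) (hmem w' (by simp [hT']))
  · have h := le_card_common_lines (a := a) (b := b) (c := c) (d := d) (e := e) (f := f)
      (q := q) (by omega) hadd hfrob fun w hw => ?_
    · rwa [hTc, hT2] at h
    · obtain ⟨h1, h2⟩ := hM w hw
      rw [hT2] at hN
      generalize Nat.card {s // IsCommonIntercept q a b c d e f w s} = m at h1 h2
      by_contra hlt
      push Not at hlt
      have h3 := harith (m + 1) q hlt
      nlinarith
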